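/- (Optimality characterization / general condition.) Let u = (u_1,…,u_n) ∈ (ℝ^d)^n, and for each index i define E_i(u) = Σ_{j : u_j ≠ u_i} (u_i − u_j)/‖u_i − u_j‖. Then u is a global minimizer of the convex clustering objective f if and only if for every ε = (ε_1,…,ε_n) ∈ (ℝ^d)^n one has Σ_{i=1}^n ⟨u_i − x_i + λ·E_i(u), ε_i⟩ + λ·Σ_{1≤j<i≤n, u_i = u_j} ‖ε_i − ε_j‖ ≥ 0. -/

import Mathlib

open scoped RealInnerProductSpace Classical

/-- The convex clustering objective:
`f(u) = (1/2)·Σ_i ‖u_i − x_i‖² + λ·Σ_{j<i} ‖u_i − u_j‖`. -/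
noncomputable def ccObj {d n : ℕ} (x : Fin n → EuclideanSpace ℝ (Fin d)) (lam : ℝ)
    (u : Fin n → EuclideanSpace ℝ (Fin d)) : ℝ :=
  (1 / 2) * ∑ i, ‖u i - x i‖ ^ 2 + lam * ∑ i, ∑ j ∈ Finset.Iio i, ‖u i - u j‖

/-- `E_i = Σ_{j : u_j ≠ u_i} (u_i − u_j)/‖u_i − u_j‖`. -/
noncomputable def ccE {d n : ℕ} (u : Fin n → EuclideanSpace ℝ (Fin d)) (i : Fin n) :
    EuclideanSpace ℝ (Fin d) :=
  ∑ j ∈ Finset.univ.filter (fun j => u j ≠ u i), ‖u i - u j‖⁻¹ • (u i - u j)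

/-- The cardinality `n(i)` of the cluster of index `i`. -/
noncomputable def ccCard {d n : ℕ} (u : Fin n → EuclideanSpace ℝ (Fin d)) (i : Fin n) : ℕ :=
  (Finset.univ.filter fun j => u j = u i).card

/-- The bounding-ball center `c(i) = u_i + λ·E_i`. -/
noncomputable def ccCenter {d n : ℕ} (u : Fin n → EuclideanSpace ℝ (Fin d)) (lam : ℝ)
    (i : Fin n) : EuclideanSpace ℝ (Fin d) :=
  u i + lam • ccE u i

/-- The bounding-ball radius `r(i) = λ·(n(i) − 1)`. -/
noncomputable def ccRadius {d n : ℕ} (u : Fin n → EuclideanSpace ℝ (Fin d)) (lam : ℝ)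
    (i : Fin n) : ℝ :=
  lam * ((ccCard u i : ℝ) - 1)

/-- A double sum of a function vanishing on the diagonal, grouped by unordered pairs. -/
theorem sum_sum_eq_sum_sum_Iio_add {ι M : Type*} [Fintype ι] [LinearOrder ι]
    [LocallyFiniteOrderBot ι] [AddCommMonoid M] (F : ι → ι → M) (hF : ∀ i, F i i = 0) :
    ∑ i, ∑ j, F i j = ∑ i, ∑ j ∈ Finset.Iio i, (F i j + F j i) := by
  have key : ∀ G : ι → ι → M,
      ∑ i, ∑ j ∈ Finset.Iio i, G i j = ∑ i, ∑ j, if j < i then G i j else 0 := by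
    intro G
    refine Finset.sum_congr rfl fun i _ => ?_
    rw [← Finset.sum_filter]
    congr 1
    ext j
    simp
  rw [key]
  have hsplit : ∀ i j, (if j < i then F i j + F j i else 0)
      = (if j < i then F i j else 0) + (if j < i then F j i else 0) := by
    intro i j
    split_ifs <;> simp
  simp only [hsplit, Finset.sum_add_distrib]
  rw [Finset.sum_comm (f := fun i j => if j < i then F j i else 0)]
  simp only [← Finset.sum_add_distrib]
  refine Finset.sum_congr rfl fun i _ => Finset.sum_congr rfl fun j _ => ?_
  rcases lt_trichotomy i j with h | rfl | h
  · simp [h, h.not_gt]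
  · simp [hF]
  · simp [h, h.not_gt]

section NormDirectionalDerivative

variable {E : Type*} [NormedAddCommGroup E] [InnerProductSpace ℝ E]

/-- The one-sided directional derivative of the norm at `a` in the direction `e`. -/
noncomputable def normDirDeriv (a e : E) : ℝ :=
  ⟪‖a‖⁻¹ • a, e⟫ + if a = 0 then ‖e‖ else 0

theorem norm_add_normDirDeriv_le (a e : E) : ‖a‖ + normDirDeriv a e ≤ ‖a + e‖ := by
  by_cases ha : a = 0
  · simp [normDirDeriv, ha]
  have hpos : 0 < ‖a‖ := norm_pos_iff.mpr ha
  have h := real_inner_le_norm a (a + e)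
  rw [inner_add_right, real_inner_self_eq_norm_sq] at h
  simp only [normDirDeriv, ha, if_false, add_zero, real_inner_smul_left]
  refine le_of_mul_le_mul_left ?_ hpos
  rw [mul_add, mul_inv_cancel_left₀ hpos.ne']
  linarith

theorem norm_add_smul_le (a e : E) {t : ℝ} (ht : 0 ≤ t) :
    ‖a + t • e‖ ≤ ‖a‖ + t * normDirDeriv a e + t ^ 2 * (‖e‖ ^ 2 / (2 * ‖a‖)) := by
  by_cases ha : a = 0
  · simp [normDirDeriv, ha, norm_smul, abs_of_nonneg ht]
  have hpos : 0 < ‖a‖ := norm_pos_iff.mpr ha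
  have h := norm_add_sq_real a (t • e)
  rw [real_inner_smul_right, norm_smul, mul_pow, Real.norm_eq_abs, sq_abs] at h
  simp only [normDirDeriv, ha, if_false, add_zero, real_inner_smul_left]
  have hsq := sq_nonneg (‖a + t • e‖ - ‖a‖)
  have hrhs : 2 * ‖a‖ * (‖a‖ + t * (‖a‖⁻¹ * ⟪a, e⟫) + t ^ 2 * (‖e‖ ^ 2 / (2 * ‖a‖)))
      = 2 * ‖a‖ ^ 2 + 2 * (t * ⟪a, e⟫) + t ^ 2 * ‖e‖ ^ 2 := by
    field_simp
  refine le_of_mul_le_mul_left ?_ (mul_pos two_pos hpos)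
  rw [hrhs]
  linarith

end NormDirectionalDerivative

section DirectionalDerivative

variable {d n : ℕ}

/-- The one-sided directional derivative of the convex clustering objective. -/
noncomputable def ccDirDeriv (x : Fin n → EuclideanSpace ℝ (Fin d)) (lam : ℝ)
    (u ε : Fin n → EuclideanSpace ℝ (Fin d)) : ℝ :=
  ∑ i, ⟪u i - x i, ε i⟫ +
    lam * ∑ i, ∑ j ∈ Finset.Iio i, normDirDeriv (u i - u j) (ε i - ε j)

theorem ccE_eq_sum (u : Fin n → EuclideanSpace ℝ (Fin d)) (i : Fin n) :
    ccE u i = ∑ j, ‖u i - u j‖⁻¹ • (u i - u j) := by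
  rw [ccE]
  refine Finset.sum_subset (Finset.filter_subset _ _) fun j _ hj => ?_
  have hj' : u j = u i := by simpa using hj
  simp [hj']

theorem ccDirDeriv_eq (x : Fin n → EuclideanSpace ℝ (Fin d)) (lam : ℝ)
    (u ε : Fin n → EuclideanSpace ℝ (Fin d)) :
    ccDirDeriv x lam u ε = ∑ i, ⟪u i - x i + lam • ccE u i, ε i⟫ +
      lam * ∑ i, ∑ j ∈ (Finset.Iio i).filter (fun j => u j = u i), ‖ε i - ε j‖ := by
  have hE : ∑ i, ⟪ccE u i, ε i⟫ =
      ∑ i, ∑ j ∈ Finset.Iio i, ⟪‖u i - u j‖⁻¹ • (u i - u j), ε i - ε j⟫ := by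
    simp only [ccE_eq_sum, sum_inner]
    rw [sum_sum_eq_sum_sum_Iio_add _ (by simp)]
    refine Finset.sum_congr rfl fun i _ => Finset.sum_congr rfl fun j _ => ?_
    rw [norm_sub_rev (u j) (u i), ← neg_sub (u i) (u j), smul_neg, inner_neg_left,
      inner_sub_right, ← sub_eq_add_neg]
  have hcluster : ∑ i, ∑ j ∈ (Finset.Iio i).filter (fun j => u j = u i), ‖ε i - ε j‖ =
      ∑ i, ∑ j ∈ Finset.Iio i, if u i - u j = 0 then ‖ε i - ε j‖ else 0 := by
    simp only [Finset.sum_filter, sub_eq_zero, eq_comm]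
  simp only [ccDirDeriv, normDirDeriv, inner_add_left, real_inner_smul_left (ccE u _),
    Finset.sum_add_distrib, ← Finset.mul_sum, hE, hcluster]
  rw [mul_add, add_assoc]
  congr!

theorem ccObj_add_ccDirDeriv_le (x : Fin n → EuclideanSpace ℝ (Fin d)) {lam : ℝ}
    (hlam : 0 ≤ lam) (u ε : Fin n → EuclideanSpace ℝ (Fin d)) :
    ccObj x lam u + ccDirDeriv x lam u ε ≤ ccObj x lam (u + ε) := by
  have hfit : (1 / 2) * ∑ i, ‖u i - x i‖ ^ 2 + ∑ i, ⟪u i - x i, ε i⟫ ≤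
      (1 / 2) * ∑ i, ‖(u + ε) i - x i‖ ^ 2 := by
    rw [Finset.mul_sum, Finset.mul_sum, ← Finset.sum_add_distrib]
    refine Finset.sum_le_sum fun i _ => ?_
    rw [Pi.add_apply, add_sub_right_comm, norm_add_sq_real]
    linarith [sq_nonneg ‖ε i‖]
  have hpen : ∑ i, ∑ j ∈ Finset.Iio i, ‖u i - u j‖ +
      ∑ i, ∑ j ∈ Finset.Iio i, normDirDeriv (u i - u j) (ε i - ε j) ≤
      ∑ i, ∑ j ∈ Finset.Iio i, ‖(u + ε) i - (u + ε) j‖ := by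
    simp only [← Finset.sum_add_distrib]
    refine Finset.sum_le_sum fun i _ => Finset.sum_le_sum fun j _ => ?_
    rw [Pi.add_apply, Pi.add_apply, add_sub_add_comm]
    exact norm_add_normDirDeriv_le _ _
  have := mul_le_mul_of_nonneg_left hpen hlam
  unfold ccObj ccDirDeriv
  linarith

theorem exists_ccObj_add_smul_le (x : Fin n → EuclideanSpace ℝ (Fin d)) {lam : ℝ}
    (hlam : 0 ≤ lam) (u ε : Fin n → EuclideanSpace ℝ (Fin d)) :
    ∃ K : ℝ, ∀ t : ℝ, 0 ≤ t →
      ccObj x lam (u + t • ε) ≤ ccObj x lam u + t * ccDirDeriv x lam u ε + t ^ 2 * K := by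
  refine ⟨(1 / 2) * ∑ i, ‖ε i‖ ^ 2 + lam * ∑ i, ∑ j ∈ Finset.Iio i,
    ‖ε i - ε j‖ ^ 2 / (2 * ‖u i - u j‖), fun t ht => ?_⟩
  have hfit : (1 / 2) * ∑ i, ‖(u + t • ε) i - x i‖ ^ 2 =
      (1 / 2) * ∑ i, ‖u i - x i‖ ^ 2 + t * ∑ i, ⟪u i - x i, ε i⟫ +
        t ^ 2 * ((1 / 2) * ∑ i, ‖ε i‖ ^ 2) := by
    simp only [Finset.mul_sum, ← Finset.sum_add_distrib]
    refine Finset.sum_congr rfl fun i _ => ?_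
    rw [Pi.add_apply, Pi.smul_apply, add_sub_right_comm, norm_add_sq_real,
      real_inner_smul_right, norm_smul, mul_pow, Real.norm_eq_abs, sq_abs]
    ring
  have hpen : ∑ i, ∑ j ∈ Finset.Iio i, ‖(u + t • ε) i - (u + t • ε) j‖ ≤
      ∑ i, ∑ j ∈ Finset.Iio i, ‖u i - u j‖ +
      t * ∑ i, ∑ j ∈ Finset.Iio i, normDirDeriv (u i - u j) (ε i - ε j) +
      t ^ 2 * ∑ i, ∑ j ∈ Finset.Iio i, ‖ε i - ε j‖ ^ 2 / (2 * ‖u i - u j‖) := by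
    simp only [Finset.mul_sum, ← Finset.sum_add_distrib]
    refine Finset.sum_le_sum fun i _ => Finset.sum_le_sum fun j _ => ?_
    simp only [Pi.add_apply, Pi.smul_apply]
    rw [add_sub_add_comm, ← smul_sub]
    exact norm_add_smul_le _ _ ht
  have := mul_le_mul_of_nonneg_left hpen hlam
  unfold ccObj ccDirDeriv
  rw [hfit]
  linarith

end DirectionalDerivative

/-- Optimality characterization: `u` is a global minimizer of the convex clustering
objective iff every directional derivative is nonnegative. -/
theorem convex_clustering_optimality_iff {d n : ℕ} (hd : 0 < d) (hn : 0 < n)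
    (x : Fin n → EuclideanSpace ℝ (Fin d)) (lam : ℝ) (hlam : 0 < lam)
    (u : Fin n → EuclideanSpace ℝ (Fin d)) :
    (∀ w : Fin n → EuclideanSpace ℝ (Fin d), ccObj x lam u ≤ ccObj x lam w) ↔
      ∀ ε : Fin n → EuclideanSpace ℝ (Fin d),
        0 ≤ ∑ i, ⟪u i - x i + lam • ccE u i, ε i⟫ +
            lam * ∑ i, ∑ j ∈ (Finset.Iio i).filter (fun j => u j = u i), ‖ε i - ε j‖ := by
  simp only [← ccDirDeriv_eq]
  constructor
  · intro hmin ε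
    obtain ⟨K, hK⟩ := exists_ccObj_add_smul_le x hlam.le u ε
    have hpos : ∀ t : ℝ, 0 < t → 0 ≤ ccDirDeriv x lam u ε + t * K := by
      intro t ht
      refine nonneg_of_mul_nonneg_right ?_ ht
      linarith [hK t ht.le, hmin (u + t • ε)]
    have hlim : Filter.Tendsto (fun t : ℝ => ccDirDeriv x lam u ε + t * K)
        (nhdsWithin 0 (Set.Ioi 0)) (nhds (ccDirDeriv x lam u ε)) := by
      have hcont : Continuous fun t : ℝ => ccDirDeriv x lam u ε + t * K := by fun_prop
      simpa using (hcont.tendsto 0).mono_left nhdsWithin_le_nhds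
    exact ge_of_tendsto hlim (Filter.eventually_of_mem self_mem_nhdsWithin hpos)
  · intro hderiv w
    have h := ccObj_add_ccDirDeriv_le x hlam.le u (w - u)
    rw [add_sub_cancel] at h
    linarith [hderiv (w - u)]
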